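/- arXiv:2001.09337 — 2 statements merged into one kernel-verified Lean document; each statement's English description precedes it below -/
import Mathlib

section
/- Let k be a field and C a k-linear abelian symmetric monoidal category which admits all small colimits, in which the tensor product commutes with small colimits in each variable, for which the canonical ring homomorphism k → End_C(𝟙) is bijective, and whose unit object 𝟙 is simple in the sense that every nonzero morphism 𝟙 → X in C is a monomorphism. Let τ : Mod(k) → C be a k-linear monoidal functor preserving small colimits. Then for a k-vector space M, the object τ(M) has a dual in C (i.e. is a dualizable/rigid object of the symmetric monoidal category C) if and only if M is finite-dimensional over k. -/
open CategoryTheory CategoryTheory.Limits CategoryTheory.MonoidalCategory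

universe v u

/-- A monoidal functor sends exact pairings to exact pairings. -/
@[reducible]
def CategoryTheory.ExactPairing.map {C D : Type*} [Category* C] [Category* D]
    [MonoidalCategory C] [MonoidalCategory D] (F : C ⥤ D) [F.Monoidal] (X Y : C)
    [ExactPairing X Y] : ExactPairing (F.obj X) (F.obj Y) where
  coevaluation' := Functor.LaxMonoidal.ε F ≫ F.map (η_ X Y) ≫ Functor.OplaxMonoidal.δ F X Y
  evaluation' := Functor.LaxMonoidal.μ F Y X ≫ F.map (ε_ X Y) ≫ Functor.OplaxMonoidal.η F
  coevaluation_evaluation' := by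
    have h := congr_arg F.map (ExactPairing.coevaluation_evaluation X Y)
    simp only [Functor.map_comp, Functor.Monoidal.map_whiskerLeft,
      Functor.Monoidal.map_whiskerRight, Functor.Monoidal.map_associator_inv,
      Functor.Monoidal.map_rightUnitor, Functor.Monoidal.map_leftUnitor_inv,
      Category.assoc, Functor.Monoidal.μ_δ_assoc] at h
    have h' := Functor.LaxMonoidal.μ F Y (𝟙_ C) ≫= h =≫ Functor.OplaxMonoidal.δ F (𝟙_ C) Y
    have h'' := F.obj Y ◁ Functor.LaxMonoidal.ε F ≫= h' =≫ Functor.OplaxMonoidal.η F ▷ F.obj Y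
    simpa [-Functor.LaxMonoidal.μ_natural_left, -Functor.LaxMonoidal.μ_natural_left_assoc,
      -Functor.LaxMonoidal.μ_natural_right, -Functor.LaxMonoidal.μ_natural_right_assoc,
      ← comp_whiskerRight_assoc, ← comp_whiskerRight,
      ← MonoidalCategory.whiskerLeft_comp_assoc, ← MonoidalCategory.whiskerLeft_comp] using h''
  evaluation_coevaluation' := by
    have h := congr_arg F.map (ExactPairing.evaluation_coevaluation X Y)
    simp only [Functor.map_comp, Functor.Monoidal.map_whiskerLeft,
      Functor.Monoidal.map_whiskerRight, Functor.Monoidal.map_associator,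
      Functor.Monoidal.map_leftUnitor, Functor.Monoidal.map_rightUnitor_inv,
      Category.assoc, Functor.Monoidal.μ_δ_assoc] at h
    have h' := Functor.LaxMonoidal.μ F (𝟙_ C) X ≫= h =≫ Functor.OplaxMonoidal.δ F X (𝟙_ C)
    have h'' := Functor.LaxMonoidal.ε F ▷ F.obj X ≫= h' =≫ F.obj X ◁ Functor.OplaxMonoidal.η F
    simpa [-Functor.LaxMonoidal.μ_natural_left, -Functor.LaxMonoidal.μ_natural_left_assoc,
      -Functor.LaxMonoidal.μ_natural_right, -Functor.LaxMonoidal.μ_natural_right_assoc,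
      ← comp_whiskerRight_assoc, ← comp_whiskerRight,
      ← MonoidalCategory.whiskerLeft_comp_assoc, ← MonoidalCategory.whiskerLeft_comp] using h''

namespace CategoryTheory

variable {C : Type*} [Category* C] [MonoidalCategory C]

/-- The trace of an endomorphism of an object with a right dual in a braided category. -/
def rightDualTrace [BraidedCategory C] {X : C} [HasRightDual X] (f : X ⟶ X) : 𝟙_ C ⟶ 𝟙_ C :=
  η_ X Xᘁ ≫ f ▷ Xᘁ ≫ (β_ X Xᘁ).hom ≫ ε_ X Xᘁ

lemma rightDualTrace_comm [BraidedCategory C] {X Y : C} [HasRightDual X] [HasRightDual Y]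
    (f : X ⟶ Y) (g : Y ⟶ X) : rightDualTrace (f ≫ g) = rightDualTrace (g ≫ f) := by
  simp only [rightDualTrace, comp_whiskerRight, Category.assoc]
  rw [← coevaluation_comp_rightAdjointMate_assoc, whisker_exchange_assoc,
    BraidedCategory.braiding_naturality_right_assoc, rightAdjointMate_comp_evaluation,
    ← BraidedCategory.braiding_naturality_left_assoc]

lemma rightDualTrace_id_tensorUnit [BraidedCategory C] :
    rightDualTrace (𝟙 (𝟙_ C)) = 𝟙 (𝟙_ C) := by
  change (ρ_ (𝟙_ C)).inv ≫ 𝟙 (𝟙_ C) ▷ 𝟙_ C ≫ (β_ (𝟙_ C) (𝟙_ C)).hom ≫ (ρ_ (𝟙_ C)).hom = _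
  simp only [braiding_tensorUnit_left, id_whiskerRight, Category.id_comp,
    unitors_equal, Iso.hom_inv_id, Iso.inv_hom_id]

lemma rightDualTrace_add [BraidedCategory C] [Preadditive C]
    [∀ X : C, (tensorRight X).Additive] {X : C} [HasRightDual X] (f g : X ⟶ X) :
    rightDualTrace (f + g) = rightDualTrace f + rightDualTrace g := by
  have h : (f + g) ▷ Xᘁ = f ▷ Xᘁ + g ▷ Xᘁ := (tensorRight Xᘁ).map_add
  simp [rightDualTrace, h]

end CategoryTheory

lemma nonempty_linearEquiv_prod_self_of_not_finite (k : Type*) [Field k] {M : Type*}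
    [AddCommGroup M] [Module k M] (h : ¬ Module.Finite k M) : Nonempty (M ≃ₗ[k] M × k) := by
  have h' : Cardinal.aleph0 ≤ Module.rank k M := by
    rwa [← not_lt, Module.rank_lt_aleph0_iff]
  refine nonempty_linearEquiv_of_lift_rank_eq ?_
  simp [Cardinal.add_one_of_aleph0_le, h']

/-- **Corollary 2.4 of Nagy–Szamuely**: in a `k`-linear abelian symmetric monoidal category `C`
with small colimits, tensor product commuting with colimits in each variable, `k ≅ End(𝟙)` and
simple unit object, a trivial object `τ(M)` is dualizable if and only if the `k`-vector space
`M` is finite-dimensional. -/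
theorem stmt2 (k : Type u) [Field k]
    (C : Type v) [Category.{u} C] [Abelian C] [CategoryTheory.Linear k C]
    [MonoidalCategory C] [SymmetricCategory C] [HasColimits C]
    [∀ X : C, PreservesColimits (tensorLeft X)]
    [∀ X : C, PreservesColimits (tensorRight X)]
    (hk : Function.Bijective (fun a : k => a • (𝟙 (𝟙_ C))))
    (hsimple : ∀ (X : C) (f : 𝟙_ C ⟶ X), f ≠ 0 → Mono f)
    (τ : ModuleCat.{u} k ⥤ C) [τ.Monoidal] [τ.Additive] [τ.Linear k]
    [PreservesColimits τ]
    (M : ModuleCat.{u} k) :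
    Nonempty (HasRightDual (τ.obj M)) ↔ FiniteDimensional k M := by
  constructor
  · rintro ⟨hM⟩
    by_contra hfin
    obtain ⟨e⟩ := nonempty_linearEquiv_prod_self_of_not_finite k hfin
    have (X : C) : (tensorRight X).Additive := by
      have := PreservesColimits.preservesFiniteColimits (tensorRight X)
      have := preservesBinaryBiproducts_of_preservesBinaryCoproducts (tensorRight X)
      exact Functor.additive_of_preservesBinaryBiproducts _
    let s : M ⟶ M := ModuleCat.ofHom (e.symm.toLinearMap ∘ₗ LinearMap.inl k M k)
    let p : M ⟶ M := ModuleCat.ofHom (LinearMap.fst k M k ∘ₗ e.toLinearMap)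
    let i : 𝟙_ (ModuleCat k) ⟶ M :=
      ModuleCat.ofHom (e.symm.toLinearMap ∘ₗ LinearMap.inr k M k)
    let q : M ⟶ 𝟙_ (ModuleCat k) := ModuleCat.ofHom (LinearMap.snd k M k ∘ₗ e.toLinearMap)
    have hsp : s ≫ p = 𝟙 M := by
      ext x
      simp [s, p]
    have hiq : i ≫ q = 𝟙 _ := by
      apply ModuleCat.hom_ext
      apply LinearMap.ext
      intro x
      change (e (e.symm (0, x))).2 = x
      simp
    have hadd : p ≫ s + q ≫ i = 𝟙 M := by
      ext x
      apply e.injective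
      change e (e.symm ((e x).1, 0) + e.symm (0, (e x).2)) = e x
      simp
    let i' : 𝟙_ C ⟶ τ.obj M := Functor.LaxMonoidal.ε τ ≫ τ.map i
    let q' : τ.obj M ⟶ 𝟙_ C := τ.map q ≫ Functor.OplaxMonoidal.η τ
    have hiq' : i' ≫ q' = 𝟙 _ := by
      simp [i', q', ← Functor.map_comp_assoc, hiq]
    have hqi' : q' ≫ i' = τ.map (q ≫ i) := by simp [i', q']
    have htr : rightDualTrace (𝟙 (τ.obj M)) = rightDualTrace (𝟙 (τ.obj M)) + 𝟙 (𝟙_ C) := by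
      calc rightDualTrace (𝟙 (τ.obj M))
          = rightDualTrace (τ.map p ≫ τ.map s) + rightDualTrace (q' ≫ i') := by
            rw [← rightDualTrace_add, hqi', ← τ.map_comp, ← τ.map_add, hadd, τ.map_id]
        _ = _ := by
            rw [rightDualTrace_comm, rightDualTrace_comm q', ← τ.map_comp, hsp, hiq', τ.map_id,
              rightDualTrace_id_tensorUnit]
    have h10 : (1 : k) = 0 := hk.injective (by simpa using htr)
    exact one_ne_zero h10
  · intro hM
    let V : FGModuleCat k := FGModuleCat.of k M
    let F : FGModuleCat k ⥤ C := (ModuleCat.isFG k).ι ⋙ τ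
    have := ExactPairing.map F V (FGModuleCat.FGModuleCatDual k V)
    exact ⟨{ rightDual := F.obj (FGModuleCat.FGModuleCatDual k V), exact := this }⟩
end

section
/- Let p be a prime with p ≠ 2 and let k be a field of characteristic p. Then there exist no polynomials f, g ∈ k[t] with g ≠ 0 and f, g coprime such that t·f′·g − t·f·g′ = t·g² − a₀·f·g in k[t], where f′, g′ denote the usual formal derivatives and a₀ = (p − 1 : k) (the image of the natural number p − 1 in k). Equivalently, the equation ∂₁(b) = 1 − (p − 1)·t^{−1}·b has no solution b in the rational function field k(t). (The key nonexistence claim, equation (1) with a₀ = p − 1, in the paper's Section 6 example.) -/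
universe u

open Polynomial

/-- In characteristic `p`, the operator `h ↦ t·h′ - h` kills the coefficients in degrees
`≡ 1 mod p`, so that `t·g ^ p` lies in its image only for `g = 0`. -/
theorem eq_zero_of_X_mul_derivative_sub_eq_X_mul_pow {p : ℕ} (hp : p.Prime) {k : Type u}
    [Field k] [CharP k p] {g h : Polynomial k}
    (H : X * derivative h - h = X * g ^ p) : g = 0 := by
  have : Fact p.Prime := ⟨hp⟩
  ext m
  have hm := congrArg (fun q => coeff q (m * p + 1)) H
  simp only [coeff_sub, coeff_X_mul, coeff_derivative, ← map_frobenius_expand p g, coeff_map,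
    coeff_expand_mul hp.pos, frobenius_def] at hm
  simpa [hp.ne_zero] using hm.symm

/-- The key nonexistence claim in the Section 6 example of Nagy–Szamuely: for `p ≠ 2` prime
and `k` of characteristic `p`, there are no coprime polynomials `f, g ∈ k[t]` with `g ≠ 0`
satisfying `t·f′·g − t·f·g′ = t·g² − a₀·f·g`, where `a₀ = p − 1` in `k`; equivalently the
equation `∂₁(b) = 1 − a₀ t⁻¹ b` has no solution `b ∈ k(t)`. -/
theorem stmt17 (p : ℕ) (hp : p.Prime) (hp2 : p ≠ 2)
    (k : Type u) [Field k] [CharP k p] :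
    ¬ ∃ f g : Polynomial k, g ≠ 0 ∧ IsCoprime f g ∧
      X * (derivative f) * g - X * f * (derivative g) =
        X * g ^ 2 - C ((p - 1 : ℕ) : k) * f * g := by
  rintro ⟨f, g, hg, -, H⟩
  refine hg (eq_zero_of_X_mul_derivative_sub_eq_X_mul_pow hp (h := f * g ^ (p - 1)) ?_)
  have ha : ((p - 1 : ℕ) : k) = -1 := by
    rw [Nat.cast_sub hp.one_le, CharP.cast_eq_zero]
    simp
  obtain ⟨n, rfl⟩ := Nat.exists_eq_add_of_le' hp.two_le
  have hn : n + 2 - 1 = n + 1 := rfl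
  rw [hn] at ha H ⊢
  rw [ha] at H
  rw [derivative_mul, derivative_pow, ha]
  simp only [map_neg, map_one, Nat.add_sub_cancel] at H ⊢
  linear_combination g ^ n * H
end
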